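/- arXiv:2409.07395 — 2 statements merged into one kernel-verified Lean document; each statement's English description precedes it below -/
import Mathlib

section
/- Let 1 < p < ∞, let γ ∈ ℝ with γ ∉ [0,n], and let f ∈ L¹_loc(ℝⁿ) (with respect to Lebesgue measure). For Q ∈ 𝒟 set b(f)_Q = ℓ(Q)^{γ/p} O(f,Q). Then there is a constant C = C(n,p,γ) such that sup_{λ>0} λᵖ ∑_{Q∈𝒟 : b(f)_Q > λ} ℓ(Q)^{−γ} |Q| ≤ C · ‖f‖ᵖ_{JNₚ(ℝⁿ,𝒟)}, i.e. the dyadic John–Nirenberg space JNₚ(ℝⁿ,𝒟) embeds into 𝒪ᵖ_γ(ℝⁿ). -/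
open MeasureTheory Set
open scoped ENNReal Classical

noncomputable section

/-- The half-open dyadic cube in `ℝⁿ` of generation `k` (sidelength `2 ^ k`) and
corner index `j`, i.e. `∏ᵢ [jᵢ 2ᵏ, (jᵢ+1) 2ᵏ)`. -/
def dyadicCube (n : ℕ) (k : ℤ) (j : Fin n → ℤ) : Set (Fin n → ℝ) :=
  Set.univ.pi fun i => Set.Ico ((j i : ℝ) * 2 ^ k) (((j i : ℝ) + 1) * 2 ^ k)

/-- The mean oscillation `O(f,E) = ⨍_E |f - ⨍_E f|` (w.r.t. Lebesgue measure). -/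
def osc {n : ℕ} (f : (Fin n → ℝ) → ℝ) (E : Set (Fin n → ℝ)) : ℝ :=
  ⨍ x in E, |f x - ⨍ y in E, f y|

/-- The `m`-th dyadic ancestor, on the level of indices. -/
def dyadicAncestor {n : ℕ} (m : ℕ) (Q : ℤ × (Fin n → ℤ)) : ℤ × (Fin n → ℤ) :=
  (Q.1 + m, fun i => Q.2 i / 2 ^ m)

lemma dyadicAncestor_zero {n : ℕ} (Q : ℤ × (Fin n → ℤ)) : dyadicAncestor 0 Q = Q := by
  simp [dyadicAncestor]

lemma dyadicAncestor_dyadicAncestor {n : ℕ} (a b : ℕ) (Q : ℤ × (Fin n → ℤ)) :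
    dyadicAncestor b (dyadicAncestor a Q) = dyadicAncestor (a + b) Q := by
  simp only [dyadicAncestor, Prod.mk.injEq]
  refine ⟨by push_cast; ring, ?_⟩
  funext i
  rw [pow_add, Int.ediv_ediv_of_nonneg (by positivity)]

lemma mem_dyadicCube_iff {n : ℕ} {k : ℤ} {j : Fin n → ℤ} {x : Fin n → ℝ} :
    x ∈ dyadicCube n k j ↔ ∀ i, ⌊x i / 2 ^ k⌋ = j i := by
  have h : (0 : ℝ) < 2 ^ k := by positivity
  simp only [dyadicCube, Set.mem_univ_pi, Set.mem_Ico, Int.floor_eq_iff, le_div_iff₀ h,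
    div_lt_iff₀ h]

lemma dyadicAncestor_eq_of_mem {n m : ℕ} {Q R : ℤ × (Fin n → ℤ)} (hm : Q.1 + m = R.1)
    {x : Fin n → ℝ} (hQ : x ∈ dyadicCube n Q.1 Q.2) (hR : x ∈ dyadicCube n R.1 R.2) :
    dyadicAncestor m Q = R := by
  rw [mem_dyadicCube_iff] at hQ hR
  refine Prod.ext hm (funext fun i => ?_)
  have h := Int.floor_div_natCast (x i / 2 ^ Q.1) (2 ^ m)
  rw [hQ i] at h
  rw [← hR i, ← hm, zpow_add₀ two_ne_zero, ← div_div]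
  simpa [dyadicAncestor] using h.symm

lemma volume_dyadicCube (n : ℕ) (k : ℤ) (j : Fin n → ℤ) :
    volume (dyadicCube n k j) = ENNReal.ofReal ((2 : ℝ) ^ ((k : ℝ) * n)) := by
  have h (i : Fin n) : ((j i : ℝ) + 1) * 2 ^ k - j i * 2 ^ k = 2 ^ k := by ring
  rw [dyadicCube, volume_pi_pi]
  simp only [Real.volume_Ico, h, Finset.prod_const, Finset.card_univ, Fintype.card_fin]
  rw [← ENNReal.ofReal_pow (by positivity), Real.rpow_mul (by positivity), Real.rpow_intCast,
    Real.rpow_natCast]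

lemma ofReal_rpow_mul_volume_dyadicCube (n : ℕ) (γ : ℝ) (Q : ℤ × (Fin n → ℤ)) :
    ENNReal.ofReal (((2 : ℝ) ^ Q.1) ^ (-γ)) * volume (dyadicCube n Q.1 Q.2) =
      ENNReal.ofReal ((2 : ℝ) ^ ((Q.1 : ℝ) * (n - γ))) := by
  rw [volume_dyadicCube, ← ENNReal.ofReal_mul (by positivity), ← Real.rpow_intCast,
    ← Real.rpow_mul (by positivity), ← Real.rpow_add (by positivity)]
  ring_nf

lemma tsum_eq_dyadicAncestor (n m : ℕ) (γ : ℝ) (Q : ℤ × (Fin n → ℤ)) :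
    ∑' R : ℤ × (Fin n → ℤ), (if dyadicAncestor m Q = R then
        ENNReal.ofReal ((2 : ℝ) ^ ((R.1 : ℝ) * (n - γ))) else 0) =
      ENNReal.ofReal ((2 : ℝ) ^ ((n : ℝ) - γ)) ^ m *
        ENNReal.ofReal ((2 : ℝ) ^ ((Q.1 : ℝ) * (n - γ))) := by
  rw [tsum_eq_single (dyadicAncestor m Q) (fun R hR => if_neg hR.symm), if_pos rfl,
    ← ENNReal.ofReal_pow (by positivity), ← ENNReal.ofReal_mul (by positivity),
    ← Real.rpow_natCast, ← Real.rpow_mul (by positivity), ← Real.rpow_add (by positivity)]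
  simp only [dyadicAncestor]
  push_cast
  ring_nf

lemma tsum_dyadicAncestor_eq_le (n m : ℕ) (γ : ℝ) (Q : ℤ × (Fin n → ℤ)) :
    ∑' R : ℤ × (Fin n → ℤ), (if dyadicAncestor m R = Q then
        ENNReal.ofReal ((2 : ℝ) ^ ((R.1 : ℝ) * (n - γ))) else 0) ≤
      ENNReal.ofReal ((2 : ℝ) ^ γ) ^ m *
        ENNReal.ofReal ((2 : ℝ) ^ ((Q.1 : ℝ) * (n - γ))) := by
  have h2 : (0 : ℤ) < 2 ^ m := by positivity
  set S : Finset (ℤ × (Fin n → ℤ)) := {Q.1 - (m : ℤ)} ×ˢ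
    Fintype.piFinset fun i => Finset.Ico (Q.2 i * 2 ^ m) ((Q.2 i + 1) * 2 ^ m) with hS
  have hcard : S.card = (2 ^ m) ^ n := by
    have h (i : Fin n) : (Q.2 i + 1) * 2 ^ m - Q.2 i * 2 ^ m = ((2 ^ m : ℕ) : ℤ) := by
      push_cast; ring
    simp only [hS, Finset.card_product, Finset.card_singleton, one_mul, Fintype.card_piFinset,
      Int.card_Ico, h, Int.toNat_natCast, Finset.prod_const, Finset.card_univ, Fintype.card_fin]
  have hmem (R : ℤ × (Fin n → ℤ)) (hR : R ∉ S) : dyadicAncestor m R ≠ Q := by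
    rintro rfl
    refine hR ?_
    simp only [hS, dyadicAncestor, Finset.mem_product, Finset.mem_singleton, add_sub_cancel_right,
      Fintype.mem_piFinset, Finset.mem_Ico, true_and]
    exact fun i => ⟨Int.ediv_mul_le _ h2.ne', Int.lt_ediv_add_one_mul_self _ h2⟩
  rw [tsum_eq_sum fun R hR => if_neg (hmem R hR)]
  calc _ ≤ ∑ R ∈ S, ENNReal.ofReal ((2 : ℝ) ^ (((Q.1 - m : ℤ) : ℝ) * (n - γ))) := by
        refine Finset.sum_le_sum fun R hR => ?_
        have hR1 : R.1 = Q.1 - m := by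
          simpa using (Finset.mem_product.1 hR).1
        rw [hR1]
        split_ifs
        exacts [le_rfl, zero_le]
    _ = _ := by
        rw [Finset.sum_const, hcard, nsmul_eq_mul, ← ENNReal.ofReal_natCast,
          ← ENNReal.ofReal_pow (by positivity), ← ENNReal.ofReal_mul (by positivity),
          ← ENNReal.ofReal_mul (by positivity)]
        push_cast
        rw [← Real.rpow_natCast, ← Real.rpow_natCast, ← Real.rpow_natCast,
          ← Real.rpow_mul (by positivity), ← Real.rpow_mul (by positivity),
          ← Real.rpow_add (by positivity), ← Real.rpow_add (by positivity)]
        ring_nf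

/-- If the weight `w` decays geometrically along a graded transitive relation, then its sum over
a set `B` on which it is bounded is controlled by the sum over the terminal elements of `B`. -/
lemma exists_terminal_tsum_le {ι : Type*} (rel : ℕ → ι → ι → Prop) (w : ι → ℝ≥0∞) (ρ : ℝ≥0∞)
    (hρ : ρ < 1) (hrefl : ∀ R, rel 0 R R)
    (htrans : ∀ a b R S T, rel a R S → rel b S T → rel (a + b) R T)
    (hsum : ∀ m Q, ∑' R, (if rel m R Q then w R else 0) ≤ ρ ^ m * w Q)
    (hw : ∀ R, w R ≠ 0) (B : Set ι) (A : ℝ≥0∞) (hA : A ≠ ⊤) (hB : ∀ Q ∈ B, w Q ≤ A) :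
    ∃ M ⊆ B, (∀ Q ∈ M, ∀ R ∈ B, ∀ m, rel m Q R → m = 0) ∧
      ∑' Q, (if Q ∈ B then w Q else 0) ≤ (1 - ρ)⁻¹ * ∑' Q, (if Q ∈ M then w Q else 0) := by
  obtain ⟨M, hM⟩ : ∃ M : Set ι, ∀ Q, Q ∈ M ↔ Q ∈ B ∧ ∀ R ∈ B, ∀ m, rel m Q R → m = 0 :=
    ⟨{Q | Q ∈ B ∧ ∀ R ∈ B, ∀ m, rel m Q R → m = 0}, fun _ => Iff.rfl⟩
  refine ⟨M, fun Q h => ((hM Q).1 h).1, fun Q h => ((hM Q).1 h).2, ?_⟩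
  have hle (m : ℕ) (R Q : ι) (h : rel m R Q) : w R ≤ ρ ^ m * w Q := by
    refine le_trans ?_ (hsum m Q)
    simpa [h] using ENNReal.le_tsum (f := fun R => if rel m R Q then w R else 0) R
  have hex (R : ι) (hR : R ∈ B) : ∃ m, ∃ Q ∈ M, rel m R Q := by
    have hbdd : BddAbove {m | ∃ Q ∈ B, rel m R Q} := by
      have ht : Filter.Tendsto (fun m : ℕ => ρ ^ m * A) Filter.atTop (nhds 0) := by
        simpa using ENNReal.Tendsto.mul_const
          (ENNReal.tendsto_pow_atTop_nhds_zero_of_lt_one hρ) (Or.inr hA)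
      obtain ⟨N, hN⟩ := Filter.eventually_atTop.1
        (ht.eventually_lt_const (pos_iff_ne_zero.2 (hw R)))
      refine ⟨N, ?_⟩
      rintro m ⟨Q, hQ, hrel⟩
      by_contra! hm
      exact (hN m hm.le).not_ge ((hle m R Q hrel).trans (by gcongr; exact hB Q hQ))
    have hne : {m | ∃ Q ∈ B, rel m R Q}.Nonempty := ⟨0, R, hR, hrefl R⟩
    obtain ⟨Q, hQ, hrel⟩ := Nat.sSup_mem hne hbdd
    refine ⟨_, Q, (hM Q).2 ⟨hQ, fun S hS m hm => ?_⟩, hrel⟩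
    have := le_csSup hbdd ⟨S, hS, htrans _ _ _ _ _ hrel hm⟩
    omega
  calc ∑' R, (if R ∈ B then w R else 0)
      ≤ ∑' R, ∑' Q, ∑' m, (if Q ∈ M then (if rel m R Q then w R else 0) else 0) := by
        refine ENNReal.tsum_le_tsum fun R => ?_
        split_ifs with hR
        · obtain ⟨m, Q, hQ, hrel⟩ := hex R hR
          refine le_trans ?_ (ENNReal.le_tsum Q)
          refine le_trans ?_ (ENNReal.le_tsum m)
          simp [hQ, hrel]
        · exact zero_le
    _ = ∑' Q, ∑' m, ∑' R, (if Q ∈ M then (if rel m R Q then w R else 0) else 0) := by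
        rw [ENNReal.tsum_comm]
        exact tsum_congr fun Q => ENNReal.tsum_comm
    _ ≤ ∑' Q, ∑' m, ρ ^ m * (if Q ∈ M then w Q else 0) := by
        refine ENNReal.tsum_le_tsum fun Q => ENNReal.tsum_le_tsum fun m => ?_
        split_ifs
        · exact hsum m Q
        · simp
    _ = _ := by
        simp_rw [ENNReal.tsum_mul_right, ENNReal.tsum_mul_left, ENNReal.tsum_geometric]

lemma osc_nonneg {n : ℕ} (f : (Fin n → ℝ) → ℝ) (E : Set (Fin n → ℝ)) : 0 ≤ osc f E := by
  rw [osc, setAverage_eq]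
  exact smul_nonneg (by positivity) (integral_nonneg fun _ => abs_nonneg _)

/-- Every cube in a super-level set contributes at least `l ^ p` times its weight to the
John–Nirenberg sum. -/
lemma ofReal_mul_weight_le {p γ l L o : ℝ} {v : ℝ≥0∞} (hp : 0 < p) (hl : 0 < l)
    (hL : 0 < L) (ho : 0 ≤ o) (h : l < L ^ (γ / p) * o) :
    ENNReal.ofReal (l ^ p) * (ENNReal.ofReal (L ^ (-γ)) * v) ≤ v * ENNReal.ofReal (o ^ p) := by
  have h1 : l ^ p ≤ L ^ γ * o ^ p := by
    have := Real.rpow_le_rpow hl.le h.le hp.le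
    rwa [Real.mul_rpow (by positivity) ho, ← Real.rpow_mul hL.le, div_mul_cancel₀ _ hp.ne'] at this
  have h2 : l ^ p * L ^ (-γ) ≤ o ^ p := by
    rw [Real.rpow_neg hL.le, ← div_eq_mul_inv, div_le_iff₀ (by positivity)]
    linarith
  rw [← mul_assoc, ← ENNReal.ofReal_mul (by positivity), mul_comm]
  gcongr

lemma pairwiseDisjoint_dyadicCube_of_terminal {n : ℕ} {M : Set (ℤ × (Fin n → ℤ))}
    (hM : ∀ Q ∈ M, ∀ R ∈ M, ∀ m, dyadicAncestor m Q = R → m = 0) :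
    M.PairwiseDisjoint fun Q => dyadicCube n Q.1 Q.2 := by
  have key (Q R : ℤ × (Fin n → ℤ)) (hQ : Q ∈ M) (hR : R ∈ M) (hle : Q.1 ≤ R.1)
      (x : Fin n → ℝ) (hxQ : x ∈ dyadicCube n Q.1 Q.2) (hxR : x ∈ dyadicCube n R.1 R.2) :
      Q = R := by
    obtain ⟨m, hm⟩ := Int.le.dest hle
    have h := dyadicAncestor_eq_of_mem hm hxQ hxR
    obtain rfl := hM Q hQ R hR m h
    rwa [dyadicAncestor_zero] at h
  intro Q hQ R hR hne
  refine Set.disjoint_left.2 fun x hxQ hxR => hne ?_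
  rcases le_total Q.1 R.1 with h | h
  · exact key Q R hQ hR h x hxQ hxR
  · exact (key R Q hR hQ h x hxR hxQ).symm

lemma exists_terminal_dyadic_tsum_le (n : ℕ) (γ : ℝ) (hγ : γ ∉ Set.Icc (0 : ℝ) n) :
    ∃ r : ℝ, 0 ≤ r ∧ r < 1 ∧ ∀ (B : Set (ℤ × (Fin n → ℤ))) (A : ℝ≥0∞), A ≠ ⊤ →
      (∀ Q ∈ B, ENNReal.ofReal ((2 : ℝ) ^ ((Q.1 : ℝ) * (n - γ))) ≤ A) →
      ∃ M ⊆ B, (M.PairwiseDisjoint fun Q => dyadicCube n Q.1 Q.2) ∧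
        ∑' Q, (if Q ∈ B then ENNReal.ofReal ((2 : ℝ) ^ ((Q.1 : ℝ) * (n - γ))) else 0) ≤
          (1 - ENNReal.ofReal r)⁻¹ *
            ∑' Q, (if Q ∈ M then ENNReal.ofReal ((2 : ℝ) ^ ((Q.1 : ℝ) * (n - γ))) else 0) := by
  have hw (R : ℤ × (Fin n → ℤ)) : ENNReal.ofReal ((2 : ℝ) ^ ((R.1 : ℝ) * (n - γ))) ≠ 0 := by
    rw [Ne, ENNReal.ofReal_eq_zero, not_le]
    positivity
  rcases lt_or_ge γ 0 with h0 | h0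
  · have hr : (2 : ℝ) ^ γ < 1 := Real.rpow_lt_one_of_one_lt_of_neg one_lt_two h0
    refine ⟨2 ^ γ, by positivity, hr, fun B A hA hB => ?_⟩
    obtain ⟨M, hMB, hM, hle⟩ := exists_terminal_tsum_le (fun m R Q => dyadicAncestor m R = Q) _ _
      (ENNReal.ofReal_lt_one.2 hr) dyadicAncestor_zero
      (by rintro a b R S T rfl rfl; rw [dyadicAncestor_dyadicAncestor])
      (fun m Q => by convert tsum_dyadicAncestor_eq_le n m γ Q) hw B A hA hB
    exact ⟨M, hMB, pairwiseDisjoint_dyadicCube_of_terminal fun Q hQ R hR => hM Q hQ R (hMB hR), hle⟩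
  · have hn : (n : ℝ) < γ := by
      by_contra! h
      exact hγ ⟨h0, h⟩
    have hr : (2 : ℝ) ^ ((n : ℝ) - γ) < 1 :=
      Real.rpow_lt_one_of_one_lt_of_neg one_lt_two (by linarith)
    refine ⟨2 ^ ((n : ℝ) - γ), by positivity, hr, fun B A hA hB => ?_⟩
    obtain ⟨M, hMB, hM, hle⟩ := exists_terminal_tsum_le (fun m R Q => dyadicAncestor m Q = R) _ _
      (ENNReal.ofReal_lt_one.2 hr) dyadicAncestor_zero
      (by rintro a b R S T rfl rfl; rw [dyadicAncestor_dyadicAncestor, add_comm])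
      (fun m Q => le_of_eq (by convert tsum_eq_dyadicAncestor n m γ Q)) hw B A hA hB
    exact ⟨M, hMB, pairwiseDisjoint_dyadicCube_of_terminal fun Q hQ R hR m h =>
      hM R hR Q (hMB hQ) m h, hle⟩

/-- for `1 < p < ∞`, `γ ∉ [0,n]` and `f ∈ L¹_loc(ℝⁿ)`, with
`b(f)_Q = ℓ(Q)^{γ/p} O(f,Q)`, one has
`sup_{λ>0} λ^p ∑_{b(f)_Q>λ} ℓ(Q)^{-γ}|Q| ≤ C ‖f‖_{JN_p(ℝⁿ,𝒟)}^p`. -/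
theorem statement9 (n : ℕ) (p γ : ℝ) (hp : 1 < p) (hγ : γ ∉ Set.Icc (0 : ℝ) n) :
    ∃ C : ℝ, 0 < C ∧
      ∀ f : (Fin n → ℝ) → ℝ, LocallyIntegrable f volume →
      (⨆ l ∈ Set.Ioi (0 : ℝ), ENNReal.ofReal (l ^ p) *
          ∑' Q : ℤ × (Fin n → ℤ),
            if l < ((2 : ℝ) ^ Q.1) ^ (γ / p) * osc f (dyadicCube n Q.1 Q.2) then
              ENNReal.ofReal (((2 : ℝ) ^ Q.1) ^ (-γ)) * volume (dyadicCube n Q.1 Q.2) else 0)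
        ≤ ENNReal.ofReal C *
          ⨆ (P : Set (ℤ × (Fin n → ℤ)))
            (_ : P.PairwiseDisjoint fun Q => dyadicCube n Q.1 Q.2),
            ∑' Q : ℤ × (Fin n → ℤ),
              if Q ∈ P then
                volume (dyadicCube n Q.1 Q.2) *
                  ENNReal.ofReal (osc f (dyadicCube n Q.1 Q.2) ^ p) else 0 := by
  obtain ⟨r, hr0, hr1, hr⟩ := exists_terminal_dyadic_tsum_le n γ hγ
  have hC : 0 < (1 - r)⁻¹ := inv_pos.2 (by linarith)
  refine ⟨(1 - r)⁻¹, hC, fun f _ => iSup₂_le fun l hl => ?_⟩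
  rw [Set.mem_Ioi] at hl
  set N : ℝ≥0∞ := ⨆ (P : Set (ℤ × (Fin n → ℤ)))
    (_ : P.PairwiseDisjoint fun Q => dyadicCube n Q.1 Q.2), ∑' Q : ℤ × (Fin n → ℤ),
      if Q ∈ P then volume (dyadicCube n Q.1 Q.2) *
        ENNReal.ofReal (osc f (dyadicCube n Q.1 Q.2) ^ p) else 0 with hN
  have hCeq : ENNReal.ofReal (1 - r)⁻¹ = (1 - ENNReal.ofReal r)⁻¹ := by
    rw [ENNReal.ofReal_inv_of_pos (by linarith), ENNReal.ofReal_sub _ hr0, ENNReal.ofReal_one]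
  by_cases hNtop : N = ⊤
  · rw [hNtop, ENNReal.mul_top (by simpa using hr1)]
    exact le_top
  set B : Set (ℤ × (Fin n → ℤ)) :=
    {Q | l < ((2 : ℝ) ^ Q.1) ^ (γ / p) * osc f (dyadicCube n Q.1 Q.2)} with hB
  have hlp : ENNReal.ofReal (l ^ p) ≠ 0 := by
    rw [Ne, ENNReal.ofReal_eq_zero, not_le]
    positivity
  have hBle (Q : ℤ × (Fin n → ℤ)) (hQ : Q ∈ B) :
      ENNReal.ofReal (l ^ p) * ENNReal.ofReal ((2 : ℝ) ^ ((Q.1 : ℝ) * (n - γ))) ≤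
        volume (dyadicCube n Q.1 Q.2) * ENNReal.ofReal (osc f (dyadicCube n Q.1 Q.2) ^ p) := by
    rw [← ofReal_rpow_mul_volume_dyadicCube]
    exact ofReal_mul_weight_le (by linarith) hl (by positivity) (osc_nonneg _ _) hQ
  have hle_N (P : Set (ℤ × (Fin n → ℤ)))
      (hP : P.PairwiseDisjoint fun Q => dyadicCube n Q.1 Q.2) (hPB : P ⊆ B) :
      ENNReal.ofReal (l ^ p) * ∑' Q : ℤ × (Fin n → ℤ),
        (if Q ∈ P then ENNReal.ofReal ((2 : ℝ) ^ ((Q.1 : ℝ) * (n - γ))) else 0) ≤ N := by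
    rw [hN, ← ENNReal.tsum_mul_left]
    refine le_iSup₂_of_le P hP (ENNReal.tsum_le_tsum fun Q => ?_)
    split_ifs with h
    · exact hBle Q (hPB h)
    · simp
  obtain ⟨M, hMB, hM, hle⟩ := hr B (N / ENNReal.ofReal (l ^ p)) (ENNReal.div_ne_top hNtop hlp) <| by
    intro Q hQ
    rw [ENNReal.le_div_iff_mul_le (Or.inl hlp) (Or.inl ENNReal.ofReal_ne_top), mul_comm]
    simpa using hle_N {Q} (Set.pairwiseDisjoint_singleton _ _) (Set.singleton_subset_iff.2 hQ)
  simp_rw [ofReal_rpow_mul_volume_dyadicCube]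
  calc _ ≤ ENNReal.ofReal (l ^ p) * ((1 - ENNReal.ofReal r)⁻¹ * ∑' Q : ℤ × (Fin n → ℤ),
        (if Q ∈ M then ENNReal.ofReal ((2 : ℝ) ^ ((Q.1 : ℝ) * (n - γ))) else 0)) := by
        gcongr
        exact hle
    _ ≤ _ := by
        rw [hCeq, mul_left_comm]
        gcongr
        exact hle_N M hM hMB
end
end

section
/- Let μ be a Radon measure on ℝ^{n+m} (a Borel measure finite on compact sets), let γ > 0 and 1 < q < ∞, let δ + ε = 1 with ε > 0, and let δ′ + ε′ = 1 with δ′ ≥ 0 and 0 < ε′ < ε. Let 𝒞 be a finite collection of dyadic rectangles in ℝ^{n+m} and set g = ∑_{R∈𝒞} ℓ_{δ,ε}(R)^{−γ/q} χ_R. Then there is a constant C (independent of 𝒞) such that ‖g‖_{L^q(ℝ^{n+m},μ)} ≤ C · (∑_{R∈𝒞} ℓ_{δ′,ε′}(R)^{−γ} μ(R))^{1/q}. -/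
open MeasureTheory Set
open scoped ENNReal Classical

noncomputable section

/-- The dyadic rectangle `Q₁ × Q₂ ⊂ ℝⁿ × ℝᵐ` indexed by
`R = ((k₁, j₁), (k₂, j₂))`. -/
def dyadicRect (n m : ℕ) (R : (ℤ × (Fin n → ℤ)) × (ℤ × (Fin m → ℤ))) :
    Set ((Fin n → ℝ) × (Fin m → ℝ)) :=
  (dyadicCube n R.1.1 R.1.2) ×ˢ (dyadicCube m R.2.1 R.2.2)

/-- The mean sidelength `ℓ_{α,β}(R) = ℓ_min(R)^α ℓ_max(R)^β` of the dyadic rectangle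
indexed by `R`, whose sidelengths are `2 ^ R.1.1` and `2 ^ R.2.1`. -/
def lMean (n m : ℕ) (R : (ℤ × (Fin n → ℤ)) × (ℤ × (Fin m → ℤ))) (α β : ℝ) : ℝ :=
  (min ((2 : ℝ) ^ R.1.1) ((2 : ℝ) ^ R.2.1)) ^ α *
    (max ((2 : ℝ) ^ R.1.1) ((2 : ℝ) ^ R.2.1)) ^ β

/-- Dyadic cubes of the same generation sharing a point coincide. -/
lemma dyadicCube_index_unique {n : ℕ} {k : ℤ} {j j' : Fin n → ℤ} {x : Fin n → ℝ}
    (h : x ∈ dyadicCube n k j) (h' : x ∈ dyadicCube n k j') : j = j' := by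
  have key : ∀ j : Fin n → ℤ, x ∈ dyadicCube n k j → ∀ i, ⌊x i / 2 ^ k⌋ = j i := by
    intro j hj i
    have hk : (0 : ℝ) < 2 ^ k := by positivity
    obtain ⟨h1, h2⟩ := hj i (mem_univ i)
    exact Int.floor_eq_iff.2 ⟨(le_div_iff₀ hk).2 h1, (div_lt_iff₀ hk).2 h2⟩
  funext i
  rw [← key j h i, ← key j' h' i]

lemma measurableSet_dyadicCube (n : ℕ) (k : ℤ) (j : Fin n → ℤ) :
    MeasurableSet (dyadicCube n k j) :=
  MeasurableSet.univ_pi fun _ => measurableSet_Ico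

lemma measurableSet_dyadicRect (n m : ℕ) (R : (ℤ × (Fin n → ℤ)) × (ℤ × (Fin m → ℤ))) :
    MeasurableSet (dyadicRect n m R) :=
  (measurableSet_dyadicCube n _ _).prod (measurableSet_dyadicCube m _ _)

/-- A dyadic rectangle containing a given point is determined by its smaller generation and the
difference of its generations. -/
lemma dyadicRect_index_unique {n m : ℕ} {R R' : (ℤ × (Fin n → ℤ)) × (ℤ × (Fin m → ℤ))}
    {z : (Fin n → ℝ) × (Fin m → ℝ)} (h : z ∈ dyadicRect n m R) (h' : z ∈ dyadicRect n m R')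
    (hmin : min R.1.1 R.2.1 = min R'.1.1 R'.2.1)
    (hsub : R.1.1 - R.2.1 = R'.1.1 - R'.2.1) : R = R' := by
  obtain ⟨⟨k₁, j₁⟩, ⟨k₂, j₂⟩⟩ := R
  obtain ⟨⟨k₁', j₁'⟩, ⟨k₂', j₂'⟩⟩ := R'
  simp only at hmin hsub
  obtain rfl : k₁ = k₁' := by omega
  obtain rfl : k₂ = k₂' := by omega
  obtain rfl := dyadicCube_index_unique h.1 h'.1
  obtain rfl := dyadicCube_index_unique h.2 h'.2
  rfl

lemma lMean_rpow (n m : ℕ) (R : (ℤ × (Fin n → ℤ)) × (ℤ × (Fin m → ℤ))) {α β : ℝ}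
    (h : α + β = 1) (t : ℝ) :
    lMean n m R α β ^ t =
      2 ^ (((min R.1.1 R.2.1 : ℤ) + β * |((R.1.1 - R.2.1 : ℤ) : ℝ)|) * t) := by
  have hmono : Monotone fun k : ℤ => (2 : ℝ) ^ k := zpow_right_mono₀ one_le_two
  obtain rfl : α = 1 - β := by linarith
  rw [lMean, ← hmono.map_min, ← hmono.map_max, ← Real.rpow_intCast, ← Real.rpow_intCast,
    ← Real.rpow_mul zero_le_two, ← Real.rpow_mul zero_le_two, ← Real.rpow_add two_pos,
    ← Real.rpow_mul zero_le_two]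
  have hmax : ((max R.1.1 R.2.1 : ℤ) : ℝ)
      = (min R.1.1 R.2.1 : ℤ) + |((R.1.1 - R.2.1 : ℤ) : ℝ)| := by
    rw [← Int.cast_abs, ← Int.cast_add]
    congr 1
    grind
  rw [hmax]
  congr 1
  ring

/-- A finite geometric family on `ℤ` is controlled by any upper bound for its terms. -/
lemma sum_geometric_le_of_forall_le {ι : Type*} (F : Finset ι) (N : ι → ℤ)
    (hN : Set.InjOn N F) {s c β : ℝ} (hs : 0 < s) (hβ : 0 ≤ β)
    (h : ∀ x ∈ F, c * (2 : ℝ) ^ (-s * N x) ≤ β) :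
    ∑ x ∈ F, c * (2 : ℝ) ^ (-s * N x) ≤ (1 - (2 : ℝ) ^ (-s))⁻¹ * β := by
  have hr0 : (0 : ℝ) ≤ 2 ^ (-s) := by positivity
  have hr1 : (2 : ℝ) ^ (-s) < 1 := Real.rpow_lt_one_of_one_lt_of_neg one_lt_two (by linarith)
  have hC : (0 : ℝ) ≤ (1 - 2 ^ (-s))⁻¹ := inv_nonneg.2 (by linarith)
  rcases F.eq_empty_or_nonempty with rfl | hF
  · simpa using mul_nonneg hC hβ
  obtain ⟨x₀, hx₀, hmin⟩ := F.exists_min_image N hF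
  have hinj : Set.InjOn (fun x => (N x - N x₀).toNat) F := by
    intro x hx y hy hxy
    have h1 := hmin x hx
    have h2 := hmin y hy
    exact hN hx hy (by simp only at hxy; omega)
  calc ∑ x ∈ F, c * (2 : ℝ) ^ (-s * N x)
      ≤ ∑ x ∈ F, ((2 : ℝ) ^ (-s)) ^ (N x - N x₀).toNat * β := by
        refine Finset.sum_le_sum fun x hx => ?_
        have hcast : (((N x - N x₀).toNat : ℕ) : ℝ) = N x - N x₀ := by
          exact_mod_cast congrArg (Int.cast : ℤ → ℝ)
            (Int.toNat_of_nonneg (sub_nonneg.2 (hmin x hx)))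
        have hsplit : c * (2 : ℝ) ^ (-s * N x)
            = ((2 : ℝ) ^ (-s)) ^ (N x - N x₀).toNat * (c * 2 ^ (-s * N x₀)) := by
          rw [← Real.rpow_natCast, ← Real.rpow_mul zero_le_two, hcast, mul_left_comm,
            ← Real.rpow_add two_pos]
          ring_nf
        rw [hsplit]
        exact mul_le_mul_of_nonneg_left (h x₀ hx₀) (by positivity)
    _ = (∑ k ∈ F.image fun x => (N x - N x₀).toNat, ((2 : ℝ) ^ (-s)) ^ k) * β := by
        rw [Finset.sum_image hinj, Finset.sum_mul]
    _ ≤ (1 - (2 : ℝ) ^ (-s))⁻¹ * β := by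
        refine mul_le_mul_of_nonneg_right ?_ hβ
        rw [← tsum_geometric_of_lt_one hr0 hr1]
        exact (summable_geometric_of_lt_one hr0 hr1).sum_le_tsum _
          fun k _ => pow_nonneg hr0 k

lemma summable_pow_natAbs {ρ : ℝ} (h0 : 0 ≤ ρ) (h1 : ρ < 1) :
    Summable fun d : ℤ => ρ ^ d.natAbs :=
  Summable.of_nat_of_neg (by simpa using summable_geometric_of_lt_one h0 h1)
    (by simpa using summable_geometric_of_lt_one h0 h1)

/-- A two-parameter geometric sum is bounded by the largest term of the corresponding family with
a smaller decay rate `ε'` in the second parameter. -/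
lemma exists_sum_rpow_le {s ε ε' : ℝ} (hs : 0 < s) (hε : ε' < ε) :
    ∃ C : ℝ, 0 < C ∧ ∀ {ι : Type*} (F : Finset ι) (N d : ι → ℤ),
      (∀ x ∈ F, ∀ y ∈ F, N x = N y → d x = d y → x = y) → ∀ β : ℝ, 0 ≤ β →
      (∀ x ∈ F, (2 : ℝ) ^ ((N x + ε' * |(d x : ℝ)|) * -s) ≤ β) →
      ∑ x ∈ F, (2 : ℝ) ^ ((N x + ε * |(d x : ℝ)|) * -s) ≤ C * β := by
  set ρ : ℝ := 2 ^ (-(s * (ε - ε'))) with hρ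
  have hρ0 : 0 ≤ ρ := by positivity
  have hρ1 : ρ < 1 := Real.rpow_lt_one_of_one_lt_of_neg one_lt_two
    (neg_neg_of_pos (mul_pos hs (sub_pos.2 hε)))
  have hr1 : (2 : ℝ) ^ (-s) < 1 := Real.rpow_lt_one_of_one_lt_of_neg one_lt_two (by linarith)
  have hsum := summable_pow_natAbs hρ0 hρ1
  have hG : 0 < (1 - (2 : ℝ) ^ (-s))⁻¹ := inv_pos.2 (by linarith)
  have hT : 0 < ∑' d : ℤ, ρ ^ d.natAbs :=
    hsum.tsum_pos (fun d => pow_nonneg hρ0 _) 0 (by simp)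
  refine ⟨(∑' d : ℤ, ρ ^ d.natAbs) * (1 - (2 : ℝ) ^ (-s))⁻¹, mul_pos hT hG, ?_⟩
  intro ι F N d hinj β hβ hle
  rw [← Finset.sum_fiberwise_of_maps_to (fun x hx => Finset.mem_image_of_mem d hx)]
  calc ∑ e ∈ F.image d, ∑ x ∈ F with d x = e, (2 : ℝ) ^ ((N x + ε * |(d x : ℝ)|) * -s)
      ≤ ∑ e ∈ F.image d, ρ ^ e.natAbs * ((1 - (2 : ℝ) ^ (-s))⁻¹ * β) := by
        refine Finset.sum_le_sum fun e _ => ?_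
        have hcongr : ∀ x ∈ F.filter (d · = e), (2 : ℝ) ^ ((N x + ε * |(d x : ℝ)|) * -s)
            = ρ ^ e.natAbs * (2 ^ (-(s * ε' * |(e : ℝ)|)) * 2 ^ (-s * N x)) := by
          intro x hx
          rw [(Finset.mem_filter.1 hx).2, hρ, ← Real.rpow_natCast, ← Real.rpow_mul zero_le_two,
            ← Real.rpow_add two_pos, ← Real.rpow_add two_pos, Nat.cast_natAbs, Int.cast_abs]
          ring_nf
        rw [Finset.sum_congr rfl hcongr, ← Finset.mul_sum]
        refine mul_le_mul_of_nonneg_left ?_ (by positivity)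
        refine sum_geometric_le_of_forall_le _ N ?_ hs hβ ?_
        · intro x hx y hy hxy
          have hx := Finset.mem_filter.1 hx
          have hy := Finset.mem_filter.1 hy
          exact hinj x hx.1 y hy.1 hxy (hx.2.trans hy.2.symm)
        · intro x hx
          have hx := Finset.mem_filter.1 hx
          refine le_trans (le_of_eq ?_) (hle x hx.1)
          rw [hx.2, ← Real.rpow_add two_pos]
          ring_nf
    _ = (∑ e ∈ F.image d, ρ ^ e.natAbs) * ((1 - (2 : ℝ) ^ (-s))⁻¹ * β) := by
        rw [Finset.sum_mul]
    _ ≤ (∑' d : ℤ, ρ ^ d.natAbs) * ((1 - (2 : ℝ) ^ (-s))⁻¹ * β) := by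
        refine mul_le_mul_of_nonneg_right ?_ (mul_nonneg hG.le hβ)
        exact hsum.sum_le_tsum _ fun e _ => pow_nonneg hρ0 _
    _ = _ := by ring

/-- The pointwise estimate `g ^ q ≤ C ^ q ∑ ℓ_{δ',ε'}(R)^{-γ} χ_R`. -/
lemma exists_pointwise_bound (n m : ℕ) {γ q δ ε δ' ε' : ℝ} (hγ : 0 < γ) (hq : 0 < q)
    (hδε : δ + ε = 1) (hδ'ε' : δ' + ε' = 1) (hε' : ε' < ε) :
    ∃ C : ℝ, 0 < C ∧ ∀ (𝓒 : Finset ((ℤ × (Fin n → ℤ)) × (ℤ × (Fin m → ℤ))))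
      (z : (Fin n → ℝ) × (Fin m → ℝ)),
      (∑ R ∈ 𝓒, lMean n m R δ ε ^ (-γ / q) *
          (dyadicRect n m R).indicator (fun _ => (1 : ℝ)) z) ^ q
        ≤ C ^ q * ∑ R ∈ 𝓒, (dyadicRect n m R).indicator
            (fun _ => lMean n m R δ' ε' ^ (-γ)) z := by
  obtain ⟨C, hC, hbound⟩ := exists_sum_rpow_le (div_pos hγ hq) hε'
  refine ⟨C, hC, fun 𝓒 z => ?_⟩
  have hL : ∑ R ∈ 𝓒, lMean n m R δ ε ^ (-γ / q) *
      (dyadicRect n m R).indicator (fun _ => (1 : ℝ)) z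
      = ∑ R ∈ 𝓒 with z ∈ dyadicRect n m R, lMean n m R δ ε ^ (-γ / q) := by
    simp [Finset.sum_filter, Set.indicator_apply]
  have hR : ∑ R ∈ 𝓒, (dyadicRect n m R).indicator (fun _ => lMean n m R δ' ε' ^ (-γ)) z
      = ∑ R ∈ 𝓒 with z ∈ dyadicRect n m R, lMean n m R δ' ε' ^ (-γ) := by
    simp [Finset.sum_filter, Set.indicator_apply]
  rw [hL, hR]
  set F := 𝓒.filter fun R => z ∈ dyadicRect n m R
  set B := ∑ R ∈ F, lMean n m R δ' ε' ^ (-γ)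
  have hnonneg : ∀ R ∈ F, 0 ≤ lMean n m R δ' ε' ^ (-γ) := fun R _ => by
    rw [lMean_rpow n m R hδ'ε']
    positivity
  have hB0 : 0 ≤ B := Finset.sum_nonneg hnonneg
  have hsum : ∑ R ∈ F, lMean n m R δ ε ^ (-γ / q) ≤ C * B ^ (1 / q) := by
    simp_rw [lMean_rpow n m _ hδε, neg_div]
    refine hbound F (fun R => min R.1.1 R.2.1) (fun R => R.1.1 - R.2.1) ?_ _ (by positivity) ?_
    · intro R hRF R' hRF'
      exact dyadicRect_index_unique (Finset.mem_filter.1 hRF).2 (Finset.mem_filter.1 hRF').2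
    · intro R hRF
      have hle := Finset.single_le_sum hnonneg hRF
      rw [lMean_rpow n m R hδ'ε'] at hle
      refine le_trans (le_of_eq ?_)
        (Real.rpow_le_rpow (by positivity) hle (one_div_pos.2 hq).le)
      rw [← Real.rpow_mul zero_le_two]
      congr 1
      ring
  have hnn : 0 ≤ ∑ R ∈ F, lMean n m R δ ε ^ (-γ / q) := Finset.sum_nonneg fun R _ => by
    rw [lMean_rpow n m R hδε]
    positivity
  calc (∑ R ∈ F, lMean n m R δ ε ^ (-γ / q)) ^ q ≤ (C * B ^ (1 / q)) ^ q :=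
        Real.rpow_le_rpow hnn hsum hq.le
    _ = C ^ q * B := by
        rw [Real.mul_rpow hC.le (by positivity), ← Real.rpow_mul hB0, one_div_mul_cancel hq.ne',
          Real.rpow_one]

/-- bi-parameter analogue of the cube-collection lemma.  For a Radon
measure `μ` on `ℝ^{n+m}`, `γ > 0`, `1 < q < ∞`, `δ + ε = 1` with `ε > 0`, and
`δ' + ε' = 1` with `δ' ≥ 0`, `0 < ε' < ε`, and a finite collection `𝒞` of dyadic
rectangles with `g = ∑_{R∈𝒞} ℓ_{δ,ε}(R)^{-γ/q} χ_R`, one has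
`‖g‖_{L^q(μ)} ≤ C (∑_{R∈𝒞} ℓ_{δ',ε'}(R)^{-γ} μ(R))^{1/q}`. -/
theorem statement11 (n m : ℕ) (γ q δ ε δ' ε' : ℝ) (hγ : 0 < γ) (hq : 1 < q)
    (hδε : δ + ε = 1) (hε : 0 < ε) (hδ'ε' : δ' + ε' = 1) (hδ' : 0 ≤ δ')
    (hε'0 : 0 < ε') (hε' : ε' < ε) :
    ∃ C : ℝ, 0 < C ∧
      ∀ (μ : Measure ((Fin n → ℝ) × (Fin m → ℝ))), IsFiniteMeasureOnCompacts μ →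
      ∀ (𝓒 : Finset ((ℤ × (Fin n → ℤ)) × (ℤ × (Fin m → ℤ)))),
      (∫⁻ z, ENNReal.ofReal
          ((∑ R ∈ 𝓒, lMean n m R δ ε ^ (-γ / q) *
            (dyadicRect n m R).indicator (fun _ => (1 : ℝ)) z) ^ q) ∂μ) ^ (1 / q)
        ≤ ENNReal.ofReal C *
          (∑ R ∈ 𝓒, ENNReal.ofReal (lMean n m R δ' ε' ^ (-γ)) * μ (dyadicRect n m R))
            ^ (1 / q) := by
  have hq0 : 0 < q := by linarith
  obtain ⟨C, hC, hbound⟩ := exists_pointwise_bound n m hγ hq0 hδε hδ'ε' hε'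
  refine ⟨C, hC, fun μ _ 𝓒 => ?_⟩
  have hCq : ENNReal.ofReal C = ENNReal.ofReal (C ^ q) ^ (1 / q) := by
    rw [ENNReal.ofReal_rpow_of_nonneg (by positivity) (by positivity), ← Real.rpow_mul hC.le,
      mul_one_div_cancel hq0.ne', Real.rpow_one]
  rw [hCq, ← ENNReal.mul_rpow_of_nonneg _ _ (by positivity : 0 ≤ 1 / q)]
  refine ENNReal.rpow_le_rpow ?_ (by positivity)
  calc _ ≤ ∫⁻ z, ENNReal.ofReal (C ^ q) * ∑ R ∈ 𝓒, (dyadicRect n m R).indicator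
          (fun _ => ENNReal.ofReal (lMean n m R δ' ε' ^ (-γ))) z ∂μ := by
        refine lintegral_mono fun z => ?_
        refine (ENNReal.ofReal_le_ofReal (hbound 𝓒 z)).trans (le_of_eq ?_)
        rw [ENNReal.ofReal_mul (by positivity), ENNReal.ofReal_sum_of_nonneg]
        · congr 1
          refine Finset.sum_congr rfl fun R _ => ?_
          by_cases hz : z ∈ dyadicRect n m R <;> simp [hz]
        · intro R _
          refine Set.indicator_nonneg (fun _ _ => ?_) z
          rw [lMean_rpow n m R hδ'ε']
          positivity
    _ = _ := by
        have hmeas : ∀ R ∈ 𝓒, Measurable ((dyadicRect n m R).indicator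
            fun _ => ENNReal.ofReal (lMean n m R δ' ε' ^ (-γ))) := fun R _ =>
          measurable_const.indicator (measurableSet_dyadicRect n m R)
        rw [lintegral_const_mul _ (Finset.measurable_fun_sum 𝓒 hmeas),
          lintegral_finsetSum 𝓒 hmeas]
        congr 1
        refine Finset.sum_congr rfl fun R _ => ?_
        rw [lintegral_indicator_const (measurableSet_dyadicRect n m R)]
end
end
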